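/- (Theorem 4) Let M be a Moore machine with initial state q0, let α : P → P be a symbol renaming, and let x, z be strings over P. Suppose that (i) α works for the string x + z, i.e. δo**(q0, x + z) = δo**(q0, (x + z) ∘ α), and (ii) there exists a symbol p ∈ P such that δt*(q0, x + p) = δt*(q0, x) and δt*(q0, (x + p) ∘ α) = δt*(q0, x ∘ α). Then for every natural number n, α works for the string x + pⁿ + z, i.e. δo**(q0, x + pⁿ + z) = δo**(q0, (x + pⁿ + z) ∘ α), where pⁿ denotes the string consisting of the symbol p repeated n times. -/

import Mathlib

/-- A Moore machine over input alphabet `P`, state set `Q`, and output alphabet `O`,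
with initial state `q0`, transition function `δt` and output function `δo`. -/
structure MooreMachine (P Q O : Type*) where
  q0 : Q
  δt : Q → P → Q
  δo : Q → O

namespace MooreMachine

variable {P Q O : Type*}

/-- The transition function over strings: `δt*(q, ε) = q`,
`δt*(q, p + x) = δt*(δt(q, p), x)`. -/
def deltaTStar (M : MooreMachine P Q O) : Q → List P → Q
  | q, [] => q
  | q, p :: x => M.deltaTStar (M.δt q p) x

/-- The output function over strings: `δo*(q, x) = δo(δt*(q, x))`. -/
def deltaOStar (M : MooreMachine P Q O) (q : Q) (x : List P) : O :=
  M.δo (M.deltaTStar q x)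

/-- The string of outputs `δo**(q, x) = [δo*(q, x|1), ..., δo*(q, x|T)]`,
where `x|i` is the prefix of `x` of length `i`. -/
def deltaOStarStar (M : MooreMachine P Q O) (q : Q) (x : List P) : List O :=
  (List.range x.length).map (fun i => M.deltaOStar q (x.take (i + 1)))

/-- A state is absorbing if every transition from it loops back to it. -/
def Absorbing (M : MooreMachine P Q O) (q : Q) : Prop :=
  ∀ p : P, M.δt q p = q

end MooreMachine

namespace MooreMachine

variable {P Q O : Type*} (M : MooreMachine P Q O)

theorem deltaTStar_append (q : Q) (x y : List P) :
    M.deltaTStar q (x ++ y) = M.deltaTStar (M.deltaTStar q x) y := by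
  induction x generalizing q with
  | nil => rfl
  | cons a x ih => exact ih _

theorem deltaTStar_replicate {q : Q} {p : P} (h : M.δt q p = q) (n : ℕ) :
    M.deltaTStar q (List.replicate n p) = q := by
  induction n with
  | zero => rfl
  | succ n ih => simpa [List.replicate_succ, deltaTStar, h] using ih

theorem deltaOStarStar_nil (q : Q) : M.deltaOStarStar q [] = [] := rfl

theorem deltaOStarStar_cons (q : Q) (a : P) (x : List P) :
    M.deltaOStarStar q (a :: x) = M.δo (M.δt q a) :: M.deltaOStarStar (M.δt q a) x := by
  simp [deltaOStarStar, deltaOStar, deltaTStar, List.range_succ_eq_map, Function.comp_def]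

theorem length_deltaOStarStar (q : Q) (x : List P) :
    (M.deltaOStarStar q x).length = x.length := by
  simp [deltaOStarStar]

theorem deltaOStarStar_append (q : Q) (x y : List P) :
    M.deltaOStarStar q (x ++ y) =
      M.deltaOStarStar q x ++ M.deltaOStarStar (M.deltaTStar q x) y := by
  induction x generalizing q with
  | nil => rfl
  | cons a x ih => simp [deltaOStarStar_cons, deltaTStar, ih]

theorem deltaOStarStar_replicate {q : Q} {p : P} (h : M.δt q p = q) (n : ℕ) :
    M.deltaOStarStar q (List.replicate n p) = List.replicate n (M.δo q) := by
  induction n with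
  | zero => rfl
  | succ n ih => simp [List.replicate_succ, deltaOStarStar_cons, h, ih]

theorem getLastD_deltaOStarStar (q : Q) (x : List P) :
    (M.deltaOStarStar q x).getLastD (M.δo q) = M.deltaOStar q x := by
  induction x generalizing q with
  | nil => rfl
  | cons a x ih => rw [deltaOStarStar_cons, List.getLastD_cons, ih]; rfl

end MooreMachine

/-- (Theorem 4) If `α` works for `x + z` and there is a symbol `p` such that reading `p`
after `x` (resp. after `x ∘ α`) leaves the reached state unchanged, then `α` works for
`x + pⁿ + z` for every `n`. -/
theorem works_pumping {P Q O : Type*} [Fintype P] [Fintype Q] [Fintype O]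
    (M : MooreMachine P Q O) (α : P → P) (x z : List P)
    (h1 : M.deltaOStarStar M.q0 (x ++ z) = M.deltaOStarStar M.q0 ((x ++ z).map α))
    (p : P)
    (h2 : M.deltaTStar M.q0 (x ++ [p]) = M.deltaTStar M.q0 x)
    (h3 : M.deltaTStar M.q0 ((x ++ [p]).map α) = M.deltaTStar M.q0 (x.map α)) :
    ∀ n : ℕ,
      M.deltaOStarStar M.q0 (x ++ List.replicate n p ++ z) =
        M.deltaOStarStar M.q0 ((x ++ List.replicate n p ++ z).map α) := by
  intro n
  simp only [List.map_append, List.map_cons, List.map_nil, M.deltaTStar_append,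
    MooreMachine.deltaTStar] at h2 h3
  simp only [List.map_append, M.deltaOStarStar_append] at h1
  obtain ⟨hx, hz⟩ := List.append_inj h1 (by simp [M.length_deltaOStarStar])
  have ho : M.δo (M.deltaTStar M.q0 x) = M.δo (M.deltaTStar M.q0 (x.map α)) := by
    have h := congrArg (List.getLastD · (M.δo M.q0)) hx
    simpa only [M.getLastD_deltaOStarStar, MooreMachine.deltaOStar] using h
  simp only [List.map_append, List.map_replicate, M.deltaOStarStar_append, M.deltaTStar_append,
    M.deltaTStar_replicate h2, M.deltaTStar_replicate h3, M.deltaOStarStar_replicate h2,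
    M.deltaOStarStar_replicate h3, hx, hz, ho]
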